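/- arXiv:1604.02758 — 9 statements merged into one kernel-verified Lean document; each statement's English description precedes it below -/
import Mathlib

section
/- Let e be an element of A. There exists a non-trivial idempotent E of the trivial extension A⋉M (i.e. E·E=E, E≠0, E≠1) such that (1−E)·X·E=0 for every X∈A⋉M, if and only if there exists a non-trivial idempotent e of A (e·e=e, e≠0, e≠1) such that (1−e)·a·e=0 for every a∈A and (1−e)·m·e=0 for every m∈M. -/
open MulOpposite TrivSqZeroExt

variable {R A M : Type*} [CommRing R] [Ring A] [Algebra R A]
  [AddCommGroup M] [Module R M] [Module A M] [Module Aᵐᵒᵖ M]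
  [SMulCommClass A Aᵐᵒᵖ M] [IsScalarTower R A M] [IsScalarTower R Aᵐᵒᵖ M]


/-- A trivial extension algebra `A ⋉ M` has a triangular matrix representation (i.e. a
non-trivial idempotent `E` with `(1 - E) * X * E = 0` for all `X`) iff there is a non-trivial
idempotent `e` of `A` with `(1 - e) * a * e = 0` for all `a ∈ A` and `(1 - e) • m • e = 0`
for all `m ∈ M`. -/
theorem stmt_0 :
    (∃ E : TrivSqZeroExt A M, E * E = E ∧ E ≠ 0 ∧ E ≠ 1 ∧
      ∀ X : TrivSqZeroExt A M, (1 - E) * X * E = 0) ↔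
    (∃ e : A, e * e = e ∧ e ≠ 0 ∧ e ≠ 1 ∧ (∀ a : A, (1 - e) * a * e = 0) ∧
      (∀ m : M, op e • ((1 - e) • m) = 0)) := by
  constructor
  · rintro ⟨E, hE, h0, h1, hX⟩
    have hsnd : E.fst • E.snd + op E.fst • E.snd = E.snd := by
      simpa using congrArg snd hE
    refine ⟨E.fst, by simpa using congrArg fst hE, fun he => h0 ?_, fun he => h1 ?_,
      fun a => by simpa using congrArg fst (hX (inl a)),
      fun m => by simpa using congrArg snd (hX (inr m))⟩
    · rw [he] at hsnd
      exact TrivSqZeroExt.ext he (by simpa using hsnd.symm)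
    · rw [he] at hsnd
      exact TrivSqZeroExt.ext he (by simpa using hsnd)
  · rintro ⟨e, he, h0, h1, ha, hm⟩
    refine ⟨inl e, by rw [← inl_mul, he], fun h => h0 (by simpa using congrArg fst h),
      fun h => h1 (by simpa using congrArg fst h), fun X => TrivSqZeroExt.ext ?_ ?_⟩
    · simpa using ha X.fst
    · simpa using hm X.snd
end

section
/- There exists a non-trivial idempotent E of the iterated trivial extension (A⋉M)⋉N such that (1−E)·X·E=0 for every X∈(A⋉M)⋉N, if and only if there exists a non-trivial idempotent e of A such that (1−e)·a·e=0 for every a∈A, (1−e)·m·e=0 for every m∈M, and (1−e)·n·e=0 for every n∈N. -/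
open MulOpposite TrivSqZeroExt

variable {R A M N : Type*} [CommRing R] [Ring A] [Algebra R A]
  [AddCommGroup M] [Module R M] [Module A M] [Module Aᵐᵒᵖ M]
  [SMulCommClass A Aᵐᵒᵖ M] [IsScalarTower R A M] [IsScalarTower R Aᵐᵒᵖ M]
  [AddCommGroup N] [Module R N] [Module A N] [Module Aᵐᵒᵖ N]
  [SMulCommClass A Aᵐᵒᵖ N] [IsScalarTower R A N] [IsScalarTower R Aᵐᵒᵖ N]

/-- The first projection `A ⋉ M → A` as a ring homomorphism. -/
def fstRingHom (A M : Type*) [Ring A] [AddCommGroup M] [Module A M] [Module Aᵐᵒᵖ M]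
    [SMulCommClass A Aᵐᵒᵖ M] : TrivSqZeroExt A M →+* A where
  toFun := TrivSqZeroExt.fst
  map_one' := rfl
  map_mul' _ _ := rfl
  map_zero' := rfl
  map_add' _ _ := rfl

/-- `N` as a left `A ⋉ M`-module via restriction of scalars along `fst`. -/
noncomputable local instance leftInst : Module (TrivSqZeroExt A M) N :=
  Module.compHom N (fstRingHom A M)

/-- `N` as a right `A ⋉ M`-module via restriction of scalars along `fst`. -/
noncomputable local instance rightInst : Module (TrivSqZeroExt A M)ᵐᵒᵖ N :=
  Module.compHom N (RingHom.op (fstRingHom A M))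

noncomputable local instance commInst :
    SMulCommClass (TrivSqZeroExt A M) (TrivSqZeroExt A M)ᵐᵒᵖ N :=
  ⟨fun x y n => smul_comm x.fst (op y.unop.fst) n⟩

/-- The iterated trivial extension `(A ⋉ M) ⋉ N` has a triangular matrix representation
iff there is a non-trivial idempotent `e` of `A` with `(1-e)·a·e = 0`, `(1-e)·m·e = 0`
and `(1-e)·n·e = 0` for all `a ∈ A`, `m ∈ M`, `n ∈ N`. -/
theorem stmt_1 :
    (∃ E : TrivSqZeroExt (TrivSqZeroExt A M) N, E * E = E ∧ E ≠ 0 ∧ E ≠ 1 ∧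
      ∀ X : TrivSqZeroExt (TrivSqZeroExt A M) N, (1 - E) * X * E = 0) ↔
    (∃ e : A, e * e = e ∧ e ≠ 0 ∧ e ≠ 1 ∧ (∀ a : A, (1 - e) * a * e = 0) ∧
      (∀ m : M, op e • ((1 - e) • m) = 0) ∧
      (∀ n : N, op e • ((1 - e) • n) = 0)) := by
  constructor
  · rintro ⟨E, hE, h0, h1, h⟩
    have hA : E.fst.fst * E.fst.fst = E.fst.fst := congrArg (fun X => X.fst.fst) hE
    have hM : E.fst.fst • E.fst.snd + op E.fst.fst • E.fst.snd = E.fst.snd :=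
      congrArg (fun X => X.fst.snd) hE
    have hN : E.fst.fst • E.snd + op E.fst.fst • E.snd = E.snd :=
      congrArg (fun X => X.snd) hE
    refine ⟨E.fst.fst, hA, fun he => h0 ?_, fun he => h1 ?_, fun a => ?_, fun m => ?_,
      fun n => ?_⟩
    · rw [he] at hM hN
      exact TrivSqZeroExt.ext (TrivSqZeroExt.ext he (by simpa using hM.symm))
        (by simpa using hN.symm)
    · rw [he] at hM hN
      exact TrivSqZeroExt.ext (TrivSqZeroExt.ext he (by simpa using hM)) (by simpa using hN)
    · exact congrArg (fun X => X.fst.fst) (h (inl (inl a)))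
    · simpa using congrArg (fun X => X.fst.snd) (h (inl (inr m)))
    · have hX : op E.fst • (1 - E.fst) • n = 0 := by
        simpa using congrArg (fun X => X.snd) (h (inr n))
      exact hX
  · rintro ⟨e, he, h0, h1, hA, hM, hN⟩
    refine ⟨inl (inl e), ?_, fun h => h0 (congrArg (fun X => X.fst.fst) h),
      fun h => h1 (congrArg (fun X => X.fst.fst) h), fun X => ?_⟩
    · rw [← inl_mul, ← inl_mul, he]
    · refine TrivSqZeroExt.ext (TrivSqZeroExt.ext (hA _) ?_) ?_
      · simpa using hM X.fst.snd
      · have hX : op (inl e : TrivSqZeroExt A M) • (1 - inl e : TrivSqZeroExt A M) • X.snd = 0 :=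
          hN X.snd
        simpa using hX
end

section
/- Let D_A: A→A, D_M: A→M, T: M→A and S: M→M be R-linear maps, and define the R-linear map D: A⋉M→A⋉M by D(a,m)=(D_A(a)+T(m), D_M(a)+S(m)). Then D is a derivation of the algebra A⋉M (i.e. D(XY)=D(X)·Y+X·D(Y) for all X,Y∈A⋉M) if and only if: D_A is a derivation of A, D_M is a derivation from A to M, T is an A-bimodule homomorphism satisfying T(m)·n+m·T(n)=0 for all m,n∈M, and S is a module generalized D_A-derivation. -/
open MulOpposite TrivSqZeroExt

variable {R A M : Type*} [CommRing R] [Ring A] [Algebra R A]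
  [AddCommGroup M] [Module R M] [Module A M] [Module Aᵐᵒᵖ M]
  [SMulCommClass A Aᵐᵒᵖ M] [IsScalarTower R A M] [IsScalarTower R Aᵐᵒᵖ M]


/-- A linear map `D(a,m) = (D_A(a) + T(m), D_M(a) + S(m))` on `A ⋉ M` is a derivation iff
`D_A` is a derivation of `A`, `D_M` is a derivation from `A` to `M`, `T` is an `A`-bimodule
homomorphism with `T(m)·n + m·T(n) = 0`, and `S` is a module generalized `D_A`-derivation. -/
theorem stmt_3 (DA : A →ₗ[R] A) (DM : A →ₗ[R] M) (T : M →ₗ[R] A) (S : M →ₗ[R] M)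
    (D : TrivSqZeroExt A M → TrivSqZeroExt A M)
    (hD : ∀ x : TrivSqZeroExt A M,
      D x = inl (DA x.fst + T x.snd) + inr (DM x.fst + S x.snd)) :
    (∀ X Y : TrivSqZeroExt A M, D (X * Y) = D X * Y + X * D Y) ↔
    ((∀ a b : A, DA (a * b) = DA a * b + a * DA b) ∧
     (∀ a b : A, DM (a * b) = op b • DM a + a • DM b) ∧
     ((∀ (a : A) (m : M), T (a • m) = a * T m) ∧
      (∀ (a : A) (m : M), T (op a • m) = T m * a) ∧
      (∀ m n : M, T m • n + op (T n) • m = 0)) ∧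
     ((∀ (a : A) (m : M), S (a • m) = a • S m + DA a • m) ∧
      (∀ (a : A) (m : M), S (op a • m) = op a • S m + op (DA a) • m))) := by
  constructor
  · intro h
    have hfst (a b : A) (m n : M) := congrArg fst (h (inl a + inr m) (inl b + inr n))
    have hsnd (a b : A) (m n : M) := congrArg snd (h (inl a + inr m) (inl b + inr n))
    simp only [hD, fst_add, snd_add, fst_mul, snd_mul, fst_inl, snd_inl, fst_inr, snd_inr,
      add_zero, zero_add] at hfst hsnd
    refine ⟨fun a b => ?_, fun a b => ?_, ⟨fun a m => ?_, fun a m => ?_, fun m n => ?_⟩,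
      fun a m => ?_, fun a m => ?_⟩
    · simpa using hfst a b 0 0
    · simpa [add_comm] using hsnd a b 0 0
    · simpa using hfst a 0 0 m
    · simpa using hfst 0 a m 0
    · simpa using (hsnd 0 0 m n).symm
    · simpa [add_comm] using hsnd a 0 0 m
    · simpa [add_comm] using hsnd 0 a m 0
  · rintro ⟨hDA, hDM, ⟨hTl, hTr, hT⟩, hSl, hSr⟩ X Y
    ext
    · simp only [hD, fst_add, fst_mul, snd_mul, fst_inl, fst_inr, add_zero, map_add,
        hDA, hTl, hTr, add_mul, mul_add, zero_mul, mul_zero]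
      abel
    · simp only [hD, fst_add, snd_add, fst_mul, snd_mul, fst_inl, snd_inl, fst_inr, snd_inr,
        add_zero, zero_add, map_add, hDM, hSl, hSr, add_smul, smul_add, op_add]
      rw [← sub_eq_zero, ← neg_eq_zero, ← hT X.snd Y.snd]
      abel
end

section
/- Suppose e∈A is an idempotent with e·a·(1−e)=0 for every a∈A, and suppose that (1−e)·m=0 and m·e=0 for every m∈M. Then every derivation D: A→M is inner; more precisely, there exists m₀∈M such that D(a)=a·m₀−m₀·a for all a∈A. -/
open MulOpposite TrivSqZeroExt

variable {R A M : Type*} [CommRing R] [Ring A] [Algebra R A]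
  [AddCommGroup M] [Module R M] [Module A M] [Module Aᵐᵒᵖ M]
  [SMulCommClass A Aᵐᵒᵖ M] [IsScalarTower R A M] [IsScalarTower R Aᵐᵒᵖ M]


/-- If `e ∈ A` is an idempotent with `e·a·(1-e) = 0` for all `a`, and `(1-e)·m = 0`,
`m·e = 0` for all `m ∈ M`, then every derivation `D : A → M` is inner:
`D(a) = a·m₀ - m₀·a` for some `m₀ ∈ M`. -/
theorem stmt_4 (e : A) (he : e * e = e)
    (h1 : ∀ a : A, e * a * (1 - e) = 0)
    (h2 : ∀ m : M, (1 - e) • m = 0)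
    (h3 : ∀ m : M, op e • m = 0)
    (D : A →ₗ[R] M) (hD : ∀ a b : A, D (a * b) = op b • D a + a • D b) :
    ∃ m₀ : M, ∀ a : A, D a = a • m₀ - op a • m₀ := by
  have e_smul (m : M) : e • m = m := by
    have h := h2 m
    rw [sub_smul, one_smul, sub_eq_zero] at h
    exact h.symm
  have mul_e (a : A) : e * a * e = e * a := by
    have h := h1 a
    rw [mul_sub, mul_one, sub_eq_zero] at h
    exact h.symm
  refine ⟨D e, fun a => ?_⟩
  have left : D (e * a) = op a • D e + D a := by rw [hD, e_smul]
  have right : D (e * a) = a • D e := by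
    rw [← mul_e, hD, h3, zero_add, mul_smul, e_smul]
  rw [← right, left, add_sub_cancel_left]
end

section
/- Assume l.Ann(M)∩r.Ann(M)=0. Let S: M→M and d: A→A be R-linear maps such that S(a·m)=a·S(m)+d(a)·m and S(m·a)=S(m)·a+m·d(a) for all a∈A and m∈M. Then d is a derivation of A, i.e. d(ab)=d(a)b+a·d(b) for all a,b∈A. -/
open MulOpposite TrivSqZeroExt

variable {R A M : Type*} [CommRing R] [Ring A] [Algebra R A]
  [AddCommGroup M] [Module R M] [Module A M] [Module Aᵐᵒᵖ M]
  [SMulCommClass A Aᵐᵒᵖ M] [IsScalarTower R A M] [IsScalarTower R Aᵐᵒᵖ M]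


/-- If `l.Ann(M) ∩ r.Ann(M) = 0` and `S : M → M`, `d : A → A` are linear maps with
`S(a·m) = a·S(m) + d(a)·m` and `S(m·a) = S(m)·a + m·d(a)`, then `d` is a derivation. -/
theorem stmt_6
    (hAnn : ∀ a : A, (∀ m : M, a • m = 0) → (∀ m : M, op a • m = 0) → a = 0)
    (S : M →ₗ[R] M) (d : A →ₗ[R] A)
    (h1 : ∀ (a : A) (m : M), S (a • m) = a • S m + d a • m)
    (h2 : ∀ (a : A) (m : M), S (op a • m) = op a • S m + op (d a) • m) :
    ∀ a b : A, d (a * b) = d a * b + a * d b := by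
  intro a b
  rw [← sub_eq_zero]
  refine hAnn _ (fun m => ?_) (fun m => ?_)
  · have h := h1 (a * b) m
    rw [mul_smul, h1 a, h1 b, mul_smul, smul_add] at h
    rw [sub_smul, add_smul, mul_smul, mul_smul, sub_eq_zero]
    exact add_left_cancel (a := a • b • S m) (by rw [← h]; abel)
  · have h := h2 (a * b) m
    rw [op_mul, mul_smul, h2 b, h2 a, mul_smul, smul_add] at h
    rw [op_sub, op_add, op_mul, op_mul, sub_smul, add_smul, mul_smul, mul_smul, sub_eq_zero]
    exact add_left_cancel (a := op b • op a • S m) (by rw [← h]; abel)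
end

section
/- Assume l.Ann(M)∩r.Ann(M)=0. Let d: A→A be a derivation and S: M→M a module generalized d-derivation. If S is inner, i.e. there exists a₀∈A with S(m)=a₀·m−m·a₀ for all m∈M, then d is inner with the same element: d(a)=a₀a−aa₀ for all a∈A. -/
open MulOpposite TrivSqZeroExt

variable {R A M : Type*} [CommRing R] [Ring A] [Algebra R A]
  [AddCommGroup M] [Module R M] [Module A M] [Module Aᵐᵒᵖ M]
  [SMulCommClass A Aᵐᵒᵖ M] [IsScalarTower R A M] [IsScalarTower R Aᵐᵒᵖ M]


/-- Assume `l.Ann(M) ∩ r.Ann(M) = 0`. If `d` is a derivation of `A`, `S` is a module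
generalized `d`-derivation and `S` is inner via `a₀`, then `d` is inner via `a₀`. -/
theorem stmt_7
    (hAnn : ∀ a : A, (∀ m : M, a • m = 0) → (∀ m : M, op a • m = 0) → a = 0)
    (d : A →ₗ[R] A) (hd : ∀ a b : A, d (a * b) = d a * b + a * d b)
    (S : M →ₗ[R] M)
    (h1 : ∀ (a : A) (m : M), S (a • m) = a • S m + d a • m)
    (h2 : ∀ (a : A) (m : M), S (op a • m) = op a • S m + op (d a) • m)
    (a₀ : A) (hS : ∀ m : M, S m = a₀ • m - op a₀ • m) :
    ∀ a : A, d a = a₀ * a - a * a₀ := by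
  intro a
  refine sub_eq_zero.mp (hAnn _ (fun m => ?_) fun m => ?_)
  · have h := h1 a m
    rw [hS, hS, smul_sub, smul_comm a (op a₀) m] at h
    simp only [sub_smul, mul_smul]
    rw [eq_sub_of_add_eq' h.symm]
    abel
  · have h := h2 a m
    rw [hS, hS, smul_sub, ← smul_comm a₀ (op a) m] at h
    simp only [op_sub, op_mul, sub_smul, mul_smul]
    rw [eq_sub_of_add_eq' h.symm]
    abel
end

section
/- Assume l.Ann(M)∩r.Ann(M)=0. Let D: A⋉M→A⋉M be a derivation of the form D(a,m)=(D_A(a), D_M(a)+S(m)) (i.e. with T=0) such that D_M: A→M is inner (D_M(a)=m₀·a−a·m₀ for some m₀∈M) and S: M→M is inner (S(m)=a₀·m−m·a₀ for some a₀∈A). Then D is an inner derivation of A⋉M; indeed D(X)=(a₀,m₀)·X−X·(a₀,m₀) for all X∈A⋉M. -/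
open MulOpposite TrivSqZeroExt

variable {R A M : Type*} [CommRing R] [Ring A] [Algebra R A]
  [AddCommGroup M] [Module R M] [Module A M] [Module Aᵐᵒᵖ M]
  [SMulCommClass A Aᵐᵒᵖ M] [IsScalarTower R A M] [IsScalarTower R Aᵐᵒᵖ M]


/-- Assume `l.Ann(M) ∩ r.Ann(M) = 0`. If `D(a,m) = (D_A(a), D_M(a) + S(m))` is a
derivation of `A ⋉ M` with `D_M` inner via `m₀` and `S` inner via `a₀`, then `D` is the
inner derivation associated with `(a₀, m₀)`. -/
theorem stmt_13
    (hAnn : ∀ a : A, (∀ m : M, a • m = 0) → (∀ m : M, op a • m = 0) → a = 0)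
    (DA : A →ₗ[R] A) (DM : A →ₗ[R] M) (S : M →ₗ[R] M)
    (D : TrivSqZeroExt A M → TrivSqZeroExt A M)
    (hD : ∀ x : TrivSqZeroExt A M, D x = inl (DA x.fst) + inr (DM x.fst + S x.snd))
    (hder : ∀ X Y : TrivSqZeroExt A M, D (X * Y) = D X * Y + X * D Y)
    (a₀ : A) (m₀ : M)
    (hDM : ∀ a : A, DM a = op a • m₀ - a • m₀)
    (hS : ∀ m : M, S m = a₀ • m - op a₀ • m) :
    ∀ X : TrivSqZeroExt A M,
      D X = (inl a₀ + inr m₀) * X - X * (inl a₀ + inr m₀) := by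
  have hDA : ∀ a : A, DA a = a₀ * a - a * a₀ := by
    intro a
    rw [← sub_eq_zero]
    apply hAnn
    · intro m
      have h := congrArg TrivSqZeroExt.snd (hder (inl a) (inr m))
      simp only [hD, hS, snd_add, snd_mul, fst_mul, fst_add, fst_inl, snd_inl, fst_inr, snd_inr,
        mul_zero, map_zero, smul_zero, add_zero, zero_add, smul_sub, op_zero, zero_smul] at h
      rw [smul_comm a (op a₀) m, sub_eq_iff_eq_add] at h
      simp only [sub_smul, mul_smul, h]
      abel
    · intro m
      have h := congrArg TrivSqZeroExt.snd (hder (inr m) (inl a))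
      simp only [hD, hS, snd_add, snd_mul, fst_mul, fst_add, fst_inl, snd_inl, fst_inr, snd_inr,
        zero_mul, map_zero, smul_zero, add_zero, zero_add, smul_sub, zero_smul] at h
      rw [smul_comm a₀ (op a) m, sub_eq_iff_eq_add] at h
      have h' := sub_eq_zero.mpr h
      simp only [op_sub, op_mul, sub_smul, mul_smul]
      rw [← neg_eq_zero, ← h']
      abel
  intro X
  rw [hD]
  ext
  · simp [hDA]
  · simp [hDM, hS]
    abel
end

section
/- Every derivation of the trivial extension A⋉M is inner if and only if the following four conditions hold: (1) every derivation d: A→A for which there exists a module generalized d-derivation S: M→M is inner; (2) every derivation D: A→M is inner; (3) every A-bimodule homomorphism S: M→M is central inner, i.e. of the form S(m)=c·m−m·c for some c∈Z(A); (4) every A-bimodule homomorphism T: M→A satisfying T(m)·n+m·T(n)=0 for all m,n∈M is zero. -/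
open MulOpposite TrivSqZeroExt

variable {R A M : Type*} [CommRing R] [Ring A] [Algebra R A]
  [AddCommGroup M] [Module R M] [Module A M] [Module Aᵐᵒᵖ M]
  [SMulCommClass A Aᵐᵒᵖ M] [IsScalarTower R A M] [IsScalarTower R Aᵐᵒᵖ M]


/-- Every derivation of `A ⋉ M` is inner iff: (1) every derivation `d` of `A` admitting a
module generalized `d`-derivation is inner; (2) every derivation `A → M` is inner; (3)
every `A`-bimodule endomorphism of `M` is central inner; (4) every `A`-bimodule
homomorphism `T : M → A` with `T(m)·n + m·T(n) = 0` vanishes. -/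
theorem stmt_16 :
    (∀ D : TrivSqZeroExt A M →ₗ[R] TrivSqZeroExt A M,
      (∀ X Y : TrivSqZeroExt A M, D (X * Y) = D X * Y + X * D Y) →
      ∃ X₀ : TrivSqZeroExt A M, ∀ X, D X = X₀ * X - X * X₀) ↔
    ((∀ d : A →ₗ[R] A, (∀ a b : A, d (a * b) = d a * b + a * d b) →
        (∃ S : M →ₗ[R] M,
          (∀ (a : A) (m : M), S (a • m) = a • S m + d a • m) ∧
          (∀ (a : A) (m : M), S (op a • m) = op a • S m + op (d a) • m)) →
        ∃ a₀ : A, ∀ a : A, d a = a₀ * a - a * a₀) ∧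
     (∀ D : A →ₗ[R] M, (∀ a b : A, D (a * b) = op b • D a + a • D b) →
        ∃ m₀ : M, ∀ a : A, D a = op a • m₀ - a • m₀) ∧
     (∀ S : M →ₗ[R] M,
        (∀ (a : A) (m : M), S (a • m) = a • S m) →
        (∀ (a : A) (m : M), S (op a • m) = op a • S m) →
        ∃ c : A, (∀ b : A, c * b = b * c) ∧ ∀ m : M, S m = c • m - op c • m) ∧
     (∀ T : M →ₗ[R] A,
        (∀ (a : A) (m : M), T (a • m) = a * T m) →
        (∀ (a : A) (m : M), T (op a • m) = T m * a) →
        (∀ m n : M, T m • n + op (T n) • m = 0) →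
        T = 0)) := by
  constructor
  · intro H
    refine ⟨fun d hd ⟨S, hSl, hSr⟩ => ?_, fun D hD => ?_, fun S hSl hSr => ?_,
      fun T hTl hTr hT => ?_⟩
    · obtain ⟨X₀, hX⟩ := H (LinearMap.prodMap d S) fun X Y => by
        refine TrivSqZeroExt.ext (hd _ _) ?_
        change S (X.fst • Y.snd + op Y.fst • X.snd) =
          (d X.fst • Y.snd + op Y.fst • S X.snd) + (X.fst • S Y.snd + op (d Y.fst) • X.snd)
        rw [map_add, hSl, hSr]
        abel
      exact ⟨X₀.fst, fun a => congrArg fst (hX (inl a))⟩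
    · obtain ⟨X₀, hX⟩ := H (LinearMap.inr R A M ∘ₗ D ∘ₗ LinearMap.fst R A M) fun X Y => by
        refine TrivSqZeroExt.ext ?_ ?_
        · change (0 : A) = 0 * Y.fst + X.fst * 0
          simp
        · change D (X.fst * Y.fst) = ((0 : A) • Y.snd + op Y.fst • D X.fst) +
            (X.fst • D Y.fst + op (0 : A) • X.snd)
          simp [hD]
      refine ⟨X₀.snd, fun a => ?_⟩
      have h : D a = (X₀ * inl a - inl a * X₀).snd := congrArg snd (hX (inl a))
      simpa using h
    · obtain ⟨X₀, hX⟩ := H (LinearMap.inr R A M ∘ₗ S ∘ₗ LinearMap.snd R A M) fun X Y => by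
        refine TrivSqZeroExt.ext ?_ ?_
        · change (0 : A) = 0 * Y.fst + X.fst * 0
          simp
        · change S (X.fst • Y.snd + op Y.fst • X.snd) =
            ((0 : A) • Y.snd + op Y.fst • S X.snd) + (X.fst • S Y.snd + op (0 : A) • X.snd)
          simp [hSl, hSr, add_comm]
      refine ⟨X₀.fst, fun a => ?_, fun m => ?_⟩
      · have h : (0 : A) = (X₀ * inl a - inl a * X₀).fst := congrArg fst (hX (inl a))
        simpa [sub_eq_zero] using h.symm
      · have h : S m = (X₀ * inr m - inr m * X₀).snd := congrArg snd (hX (inr m))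
        simpa using h
    · obtain ⟨X₀, hX⟩ := H (LinearMap.inl R A M ∘ₗ T ∘ₗ LinearMap.snd R A M) fun X Y => by
        refine TrivSqZeroExt.ext ?_ ?_
        · change T (X.fst • Y.snd + op Y.fst • X.snd) = T X.snd * Y.fst + X.fst * T Y.snd
          rw [map_add, hTl, hTr, add_comm]
        · change (0 : M) = (T X.snd • Y.snd + op Y.fst • (0 : M)) +
            (X.fst • (0 : M) + op (T Y.snd) • X.snd)
          simpa using (hT X.snd Y.snd).symm
      ext m
      have h : T m = (X₀ * inr m - inr m * X₀).fst := congrArg fst (hX (inr m))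
      simpa using h
  · rintro ⟨H₁, H₂, H₃, H₄⟩ D hD
    let d : A →ₗ[R] A := LinearMap.fst R A M ∘ₗ D ∘ₗ LinearMap.inl R A M
    let δ : A →ₗ[R] M := LinearMap.snd R A M ∘ₗ D ∘ₗ LinearMap.inl R A M
    let T : M →ₗ[R] A := LinearMap.fst R A M ∘ₗ D ∘ₗ LinearMap.inr R A M
    let S : M →ₗ[R] M := LinearMap.snd R A M ∘ₗ D ∘ₗ LinearMap.inr R A M
    have d_eq (a : A) : (D (inl a)).fst = d a := rfl
    have δ_eq (a : A) : (D (inl a)).snd = δ a := rfl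
    have T_eq (m : M) : (D (inr m)).fst = T m := rfl
    have S_eq (m : M) : (D (inr m)).snd = S m := rfl
    have hll (a b : A) := hD (inl a) (inl b)
    have hlr (a : A) (m : M) := hD (inl a) (inr m)
    have hrl (a : A) (m : M) := hD (inr m) (inl a)
    have hrr (m n : M) := hD (inr m) (inr n)
    simp only [inl_mul_inl, inl_mul_inr, inr_mul_inl, inr_mul_inr, map_zero,
      TrivSqZeroExt.ext_iff, fst_add, snd_add, fst_mul, snd_mul, fst_inl, snd_inl,
      fst_inr, snd_inr, fst_zero, snd_zero, d_eq, δ_eq, T_eq, S_eq, smul_zero, zero_smul,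
      mul_zero, zero_mul, add_zero, zero_add, op_zero] at hll hlr hrl hrr
    have hSl (a : A) (m : M) : S (a • m) = a • S m + d a • m := by
      rw [(hlr a m).2, add_comm]
    have hSr (a : A) (m : M) : S (op a • m) = op a • S m + op (d a) • m := (hrl a m).2
    obtain ⟨a₀, ha₀⟩ := H₁ d (fun a b => (hll a b).1) ⟨S, hSl, hSr⟩
    obtain ⟨m₀, hm₀⟩ := H₂ δ fun a b => (hll a b).2
    have hT : T = 0 :=
      H₄ T (fun a m => (hlr a m).1) (fun a m => (hrl a m).1) fun m n => (hrr m n).2.symm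
    obtain ⟨c, hc, hcS⟩ := H₃
      (S - (Algebra.lsmul R R M a₀ - Algebra.lsmul R R M (op a₀)))
      (fun a m => by
        simp only [LinearMap.sub_apply, Algebra.lsmul_coe, hSl, ha₀, sub_smul, mul_smul,
          smul_sub, smul_comm a (op a₀) m]
        abel)
      (fun a m => by
        simp only [LinearMap.sub_apply, Algebra.lsmul_coe, hSr, ha₀, op_sub, op_mul, sub_smul,
          mul_smul, smul_sub, smul_comm a₀ (op a) m]
        abel)
    refine ⟨inl (a₀ + c) + inr m₀, fun X => ?_⟩
    rw [← inl_fst_add_inr_snd_eq X]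
    generalize X.fst = a
    generalize X.snd = m
    have hS : S m = a₀ • m - op a₀ • m + (c • m - op c • m) := by
      rw [← hcS m]
      simp
    ext
    · simp only [map_add, fst_add, d_eq, T_eq, hT, ha₀, fst_sub, fst_mul, fst_inl, fst_inr,
        LinearMap.zero_apply, add_zero, mul_zero, zero_mul, add_mul, mul_add, hc a]
      abel
    · simp only [map_add, snd_add, δ_eq, S_eq, hS, hm₀, snd_sub, snd_mul, fst_add, fst_inl,
        fst_inr, snd_inl, snd_inr, add_zero, zero_add, add_smul, op_add]
      abel
end

section
/- Assume l.Ann(M)∩r.Ann(M)=0, and suppose c∈A satisfies m·c=0 for all m∈M and m=c·m−m·c for all m∈M. Then c is an idempotent (c·c=c), (1−c)·a·c=0 for every a∈A, and (1−c)·m·c=0 for every m∈M; moreover, if M≠0 then c≠0 and c≠1, so that the trivial extension A⋉M has a triangular matrix representation. -/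
open MulOpposite TrivSqZeroExt

variable {R A M : Type*} [CommRing R] [Ring A] [Algebra R A]
  [AddCommGroup M] [Module R M] [Module A M] [Module Aᵐᵒᵖ M]
  [SMulCommClass A Aᵐᵒᵖ M] [IsScalarTower R A M] [IsScalarTower R Aᵐᵒᵖ M]


/-- Assume `l.Ann(M) ∩ r.Ann(M) = 0`. If `c ∈ A` satisfies `m·c = 0` and `m = c·m - m·c`
for all `m ∈ M`, then `c` is idempotent, `(1-c)·a·c = 0` for all `a`, `(1-c)·m·c = 0` for
all `m`; and if `M ≠ 0` then `c` is non-trivial, so `A ⋉ M` has a triangular matrix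
representation. -/
theorem stmt_18
    (hAnn : ∀ a : A, (∀ m : M, a • m = 0) → (∀ m : M, op a • m = 0) → a = 0)
    (c : A) (hc1 : ∀ m : M, op c • m = 0)
    (hc2 : ∀ m : M, m = c • m - op c • m) :
    c * c = c ∧ (∀ a : A, (1 - c) * a * c = 0) ∧
    (∀ m : M, op c • ((1 - c) • m) = 0) ∧
    ((∃ m : M, m ≠ 0) → c ≠ 0 ∧ c ≠ 1 ∧
      ∃ e : A, e * e = e ∧ e ≠ 0 ∧ e ≠ 1 ∧ (∀ a : A, (1 - e) * a * e = 0) ∧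
        (∀ m : M, op e • ((1 - e) • m) = 0)) := by
  have hc (m : M) : c • m = m := by simpa [hc1] using (hc2 m).symm
  have htri (a : A) : (1 - c) * a * c = 0 := by
    refine hAnn _ (fun m => ?_) (fun m => ?_)
    · simp [mul_smul, sub_smul, hc]
    · rw [op_mul, mul_smul, hc1]
  have hidem : c * c = c := by
    have h := htri 1
    rw [mul_one, sub_mul, one_mul, sub_eq_zero] at h
    exact h.symm
  refine ⟨hidem, htri, fun m => hc1 _, ?_⟩
  rintro ⟨m, hm⟩
  have h0 : c ≠ 0 := by
    rintro rfl
    exact hm (by simpa using (hc m).symm)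
  have h1 : c ≠ 1 := by
    rintro rfl
    exact hm (by simpa using hc1 m)
  exact ⟨h0, h1, c, hidem, h0, h1, htri, fun m => hc1 _⟩
end
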